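/- Let 𝒜, ℬ be m-th order n-dimensional tensors with ℬ strictly copositive. Then the tensor generalized eigenvalue complementarity problem with K = ℝ₊ⁿ has at least one solution: there exist λ̄ ∈ ℝ and x̄ ∈ ℝ₊ⁿ \ {0} with λ̄ℬx̄^{m−1} − 𝒜x̄^{m−1} ≥ 0 and ⟨x̄, λ̄ℬx̄^{m−1} − 𝒜x̄^{m−1}⟩ = 0. -/

import Mathlib

open Finset

noncomputable def tpow {m n : ℕ} (A : (Fin m → Fin n) → ℝ) (x : Fin n → ℝ) : ℝ :=
  ∑ i : Fin m → Fin n, A i * ∏ k, x (i k)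

noncomputable def tmap {m n : ℕ} [NeZero m] (A : (Fin m → Fin n) → ℝ) (x : Fin n → ℝ)
    (i : Fin n) : ℝ :=
  ∑ j : Fin m → Fin n, if j 0 = i then A j * ∏ k ∈ Finset.univ.erase (0 : Fin m), x (j k) else 0

def TSymm {m n : ℕ} (A : (Fin m → Fin n) → ℝ) : Prop :=
  ∀ (σ : Equiv.Perm (Fin m)) (i : Fin m → Fin n), A (i ∘ σ) = A i

/-- No `y` beats every point of `σ` in all of the orders `r i` simultaneously. -/
def Dominant {I U : Type*} (r : I → U → ℕ) (σ : Finset U) : Prop :=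
  ∀ y, ∃ i, ∀ x ∈ σ, r i y ≤ r i x

theorem Dominant.mono {I U : Type*} {r : I → U → ℕ} {σ τ : Finset U}
    (h : Dominant r σ) (hτ : τ ⊆ σ) : Dominant r τ := fun y =>
  (h y).imp fun _ hi x hx => hi x (hτ hx)

theorem exists_unique_argmax {U : Type*} [Fintype U] {f : U → ℕ} (hf : Function.Injective f)
    {p : U → Prop} (hp : ∃ x, p x) :
    ∃ x, ∀ z, (p z ∧ ∀ y, p y → f y ≤ f z) ↔ z = x := by
  classical
  obtain ⟨x, hx, hmax⟩ := Finset.exists_max_image (univ.filter p) f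
    (hp.imp fun x hx => by simpa using hx)
  simp only [mem_filter, mem_univ, true_and] at hx hmax
  refine ⟨x, fun z => ⟨fun hz => hf (le_antisymm (hmax z hz.1) (hz.2 x hx)), ?_⟩⟩
  rintro rfl
  exact ⟨hx, hmax⟩

theorem injOn_of_surjOn_card {I U : Type*} [DecidableEq U] {m : I → U}
    {J : Finset I} {τ : Finset U} (hs : ∀ x ∈ τ, ∃ i ∈ J, m i = x) (hc : #J ≤ #τ) :
    Set.InjOn m J := by
  apply Finset.card_image_iff.mp
  refine le_antisymm card_image_le (hc.trans (card_le_card fun x hx => ?_))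
  simpa using hs x hx

/-- A set that misses a colour has zero or two facets coloured by all colours but `i₀`. -/
theorem even_card_colored_facets {I U : Type*} [Fintype I] [DecidableEq I] [DecidableEq U]
    {c : U → I} {σ : Finset U} (hσ : #σ = Fintype.card I) (i₀ : I) (hc : σ.image c ≠ univ) :
    Even #{x ∈ σ | (σ.erase x).image c = univ.erase i₀} := by
  rcases Finset.eq_empty_or_nonempty {x ∈ σ | (σ.erase x).image c = univ.erase i₀} with h | ⟨x, hx⟩
  · simp [h]
  obtain ⟨hxσ, hx⟩ := mem_filter.mp hx
  have himg : ∀ y ∈ σ, σ.image c = insert (c y) ((σ.erase y).image c) := fun y hy => by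
    rw [← image_insert, insert_erase hy]
  have hx0 : c x ≠ i₀ := fun h => hc (by rw [himg x hxσ, hx, h, insert_erase (mem_univ _)])
  have hinj : Set.InjOn c (σ.erase x) := by
    apply Finset.card_image_iff.mp
    rw [hx, card_erase_of_mem (mem_univ _), card_erase_of_mem hxσ, card_univ, hσ]
  obtain ⟨y, hy, hyx⟩ : ∃ y ∈ σ.erase x, c y = c x := by
    rw [← mem_image, hx]
    simpa using hx0
  obtain ⟨hyne, hyσ⟩ := mem_erase.mp hy
  have : {x ∈ σ | (σ.erase x).image c = univ.erase i₀} = {x, y} := by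
    ext z
    simp only [mem_filter, mem_insert, mem_singleton]
    constructor
    · rintro ⟨hzσ, hz⟩
      by_contra! hne
      have hzi : c z ∈ univ.erase i₀ := by
        rw [← hx]
        exact mem_image_of_mem c (by simp [hne.1, hzσ])
      rw [← hz] at hzi
      obtain ⟨w, hw, hwz⟩ := mem_image.mp hzi
      obtain ⟨hwne, hwσ⟩ := mem_erase.mp hw
      by_cases hwx : w = x
      · subst hwx
        exact hne.2 (hinj (by simp [hne.1, hzσ]) hy (by rw [hyx, hwz]))
      · exact hwne (hinj (by simp [hwx, hwσ]) (by simp [hne.1, hzσ]) hwz)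
    · rintro (rfl | rfl)
      · exact ⟨hxσ, hx⟩
      · refine ⟨hyσ, ?_⟩
        rw [← hx]
        ext i
        simp only [mem_image, mem_erase]
        constructor
        · rintro ⟨w, ⟨hw, hwσ⟩, rfl⟩
          by_cases hwx : w = x
          · exact ⟨z, ⟨hyne, hyσ⟩, by rw [hyx, hwx]⟩
          · exact ⟨w, ⟨hwx, hwσ⟩, rfl⟩
        · rintro ⟨w, ⟨hw, hwσ⟩, rfl⟩
          by_cases hwx : w = z
          · exact ⟨x, ⟨hyne.symm, hxσ⟩, by rw [hwx, hyx]⟩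
          · exact ⟨w, ⟨hwx, hwσ⟩, rfl⟩
  rw [this, card_pair hyne.symm]
  exact even_two

section Scarf

variable {I U : Type*} [Fintype I] [DecidableEq I] [Fintype U] [DecidableEq U]
  {r : I → U → ℕ}

open Classical in
/-- A facet containing a non-slack point is contained in zero or two dominant sets. -/
theorem even_card_dominant_insert (hr : ∀ i, Function.Injective (r i)) {s : I → U}
    {τ : Finset U} (hτ : #τ + 1 = Fintype.card I) {t : U} (ht : t ∈ τ)
    (hts : ∀ i j, j ≠ i → r i t < r i (s j)) :
    Even #{x | x ∉ τ ∧ Dominant r (insert x τ)} := by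
  by_cases hτD : Dominant r τ
  swap
  · rw [Finset.filter_false_of_mem]
    · simp
    · rintro x - ⟨-, hx⟩
      exact hτD (hx.mono (subset_insert _ _))
  choose m hmτ hm using fun i => Finset.exists_min_image τ (r i) ⟨t, ht⟩
  have hsurj : ∀ x ∈ τ, ∃ i, m i = x := fun x hx => by
    obtain ⟨i, hi⟩ := hτD x
    exact ⟨i, hr i (le_antisymm (hm i x hx) (hi _ (hmτ i)))⟩
  obtain ⟨a, -, b, -, hab, hmab⟩ := Finset.exists_ne_map_eq_of_card_lt_of_maps_to
    (s := (univ : Finset I)) (t := τ) (f := m) (by rw [card_univ]; omega) (fun i _ => hmτ i)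
  have hsurj' : ∀ j, j = a ∨ j = b → ∀ x ∈ τ, ∃ i, i ≠ j ∧ m i = x := by
    intro j hj x hx
    obtain ⟨i, hi⟩ := hsurj x hx
    by_cases hij : i = j
    · rcases hj with hj | hj
      · exact ⟨b, by grind, by grind⟩
      · exact ⟨a, by grind, by grind⟩
    · exact ⟨i, hij, hi⟩
  have key : ∀ x, (x ∉ τ ∧ Dominant r (insert x τ)) ↔ ∃ j, (j = a ∨ j = b) ∧
      ((∀ i, i ≠ j → r i (m i) < r i x) ∧
        ∀ y, (∀ i, i ≠ j → r i (m i) < r i y) → r j y ≤ r j x) := by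
    intro x
    constructor
    · rintro ⟨hx, hD⟩
      have hrep : ∀ z ∈ τ, ∃ i, m i = z ∧ r i z < r i x := fun z hz => by
        obtain ⟨i, hi⟩ := hD z
        refine ⟨i, hr i (le_antisymm (hm i z hz) (hi _ (by simp [hmτ i]))), ?_⟩
        refine lt_of_le_of_ne (hi x (by simp)) fun h => hx ?_
        rwa [← hr i h]
      obtain ⟨j, hj⟩ := hD x
      have hrepj : ∀ z ∈ τ, ∃ i ∈ univ.erase j, m i = z := fun z hz => by
        obtain ⟨i, hi, hi'⟩ := hrep z hz
        refine ⟨i, ?_, hi⟩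
        simp only [mem_erase, mem_univ, and_true]
        rintro rfl
        exact absurd (hj z (by simp [hz])) (not_le.mpr hi')
      have hinj := injOn_of_surjOn_card hrepj
        (by rw [card_erase_of_mem (mem_univ _), card_univ]; omega)
      refine ⟨j, ?_, ?_, ?_⟩
      · by_contra! h
        exact hab (hinj (by simp [h.1.symm]) (by simp [h.2.symm]) hmab)
      · intro i hij
        by_contra! h
        obtain ⟨k, hk, hk'⟩ := hrep (m i) (hmτ i)
        have hkj : k ≠ j := by
          rintro rfl
          exact absurd (hj (m i) (by simp [hmτ i])) (not_le.mpr hk')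
        have hki : k = i := hinj (by simp [hkj]) (by simp [hij]) hk
        subst hki
        exact absurd h (not_le.mpr hk')
      · intro y hy
        obtain ⟨i, hi⟩ := hD y
        by_cases hij : i = j
        · subst hij
          exact hi x (by simp)
        · exact absurd (hi (m i) (by simp [hmτ i])) (not_le.mpr (hy i hij))
    · rintro ⟨j, hj, hx, hmax⟩
      refine ⟨fun hxτ => ?_, fun y => ?_⟩
      · obtain ⟨i, hij, rfl⟩ := hsurj' j hj x hxτ
        exact lt_irrefl _ (hx i hij)
      · by_cases hy : ∀ i, i ≠ j → r i (m i) < r i y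
        · obtain ⟨i, hi⟩ := hτD y
          by_cases hij : i = j
          · subst hij
            refine ⟨i, fun z hz => ?_⟩
            rcases mem_insert.mp hz with rfl | hz
            · exact hmax y hy
            · exact hi z hz
          · exact absurd (hi (m i) (hmτ i)) (not_le.mpr (hy i hij))
        · push Not at hy
          obtain ⟨i, hij, hi⟩ := hy
          refine ⟨i, fun z hz => ?_⟩
          rcases mem_insert.mp hz with rfl | hz
          · exact hi.trans (hx i hij).le
          · exact hi.trans (hm i z hz)
  have hne : ∀ j, ∃ x, ∀ i, i ≠ j → r i (m i) < r i x := fun j =>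
    ⟨s j, fun i hij => (hm i t ht).trans_lt (hts i j hij.symm)⟩
  obtain ⟨xa, hxa⟩ := exists_unique_argmax (hr a) (hne a)
  obtain ⟨xb, hxb⟩ := exists_unique_argmax (hr b) (hne b)
  have hxab : xa ≠ xb := by
    rintro rfl
    have h1 := ((hxa xa).mpr rfl).1
    have h2 := ((hxb xa).mpr rfl).1
    obtain ⟨i, hi⟩ := hτD xa
    have h3 := hi (m i) (hmτ i)
    by_cases hia : i = a
    · exact absurd h3 (not_le.mpr (h2 i (by grind)))
    · exact absurd h3 (not_le.mpr (h1 i hia))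
  have : ({x | x ∉ τ ∧ Dominant r (insert x τ)} : Finset U) = {xa, xb} := by
    ext x
    simp only [mem_filter, mem_univ, true_and, key, mem_insert, mem_singleton]
    rw [← hxa, ← hxb]
    constructor
    · rintro ⟨j, rfl | rfl, h⟩
      · exact Or.inl h
      · exact Or.inr h
    · rintro (h | h)
      · exact ⟨a, Or.inl rfl, h⟩
      · exact ⟨b, Or.inr rfl, h⟩
  rw [this, card_pair hxab]
  exact even_two

open Classical in
/-- The facet made of all slack points but one lies in exactly one dominant set. -/
theorem card_dominant_insert_slack (hr : ∀ i, Function.Injective (r i)) {s : I → U}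
    (hlow : ∀ i y, r i (s i) ≤ r i y)
    (hhigh : ∀ i j y, j ≠ i → y ∉ Set.range s → r i y < r i (s j))
    (hs : Function.Injective s) (i₀ : I) :
    #{x | x ∉ (univ.erase i₀).image s ∧ Dominant r (insert x ((univ.erase i₀).image s))} = 1 := by
  obtain ⟨x, hx⟩ := exists_unique_argmax (hr i₀) (p := fun x => x ∉ (univ.erase i₀).image s)
    ⟨s i₀, by simp [hs.eq_iff]⟩
  rw [Finset.card_eq_one]
  refine ⟨x, ?_⟩
  ext z
  simp only [mem_filter, mem_univ, true_and, mem_singleton]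
  rw [← hx]
  refine and_congr_right fun hz => ⟨fun hD y hy => ?_, fun hmax y => ?_⟩
  · obtain ⟨i, hi⟩ := hD y
    by_cases hi0 : i = i₀
    · subst hi0
      exact hi z (by simp)
    · have hsi : s i ∈ (univ.erase i₀).image s := mem_image_of_mem s (by simp [hi0])
      have := hr i (le_antisymm (hi (s i) (mem_insert_of_mem hsi)) (hlow i y))
      exact absurd (this ▸ hsi) hy
  · by_cases hy : y ∈ (univ.erase i₀).image s
    · obtain ⟨i, -, rfl⟩ := mem_image.mp hy
      exact ⟨i, fun _ _ => hlow i _⟩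
    · refine ⟨i₀, fun w hw => ?_⟩
      rcases mem_insert.mp hw with rfl | hw
      · exact hmax y hy
      · obtain ⟨k, hk, rfl⟩ := mem_image.mp hw
        by_cases hys : y ∈ Set.range s
        · obtain ⟨l, rfl⟩ := hys
          have : l = i₀ := by
            by_contra h
            exact hy (mem_image_of_mem s (by simp [h]))
          subst this
          exact hlow _ _
        · exact (hhigh i₀ k y (by simpa using hk) hys).le

/-- Scarf's theorem on primitive sets: some dominant set carries all colours. -/
theorem exists_dominant_colorful [Nonempty I] (hr : ∀ i, Function.Injective (r i)) {s : I → U}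
    (hlow : ∀ i y, r i (s i) ≤ r i y)
    (hhigh : ∀ i j y, j ≠ i → y ∉ Set.range s → r i y < r i (s j))
    {c : U → I} (hcs : ∀ i, c (s i) = i) :
    ∃ σ : Finset U, Dominant r σ ∧ σ.image c = univ := by
  classical
  by_contra! hno
  have hs : Function.Injective s := Function.LeftInverse.injective hcs
  obtain ⟨i₀⟩ := ‹Nonempty I›
  let doors : Finset (Finset U) :=
    {τ | #τ + 1 = Fintype.card I ∧ τ.image c = univ.erase i₀}
  let rooms : Finset (Finset U) := {σ | #σ = Fintype.card I ∧ Dominant r σ}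
  let up : Finset U → Finset U := fun τ => {x | x ∉ τ ∧ Dominant r (insert x τ)}
  let down : Finset U → Finset U := fun σ => {x ∈ σ | (σ.erase x).image c = univ.erase i₀}
  have hcount : ∑ τ ∈ doors, #(up τ) = ∑ σ ∈ rooms, #(down σ) := by
    rw [← card_sigma, ← card_sigma]
    refine Finset.card_nbij' (fun p => ⟨insert p.2 p.1, p.2⟩) (fun p => ⟨p.1.erase p.2, p.2⟩)
      ?_ ?_ ?_ ?_
    · rintro ⟨τ, x⟩ h
      simp only [doors, up, rooms, down, coe_sigma, Set.mem_sigma_iff, mem_coe, mem_filter,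
        mem_univ, true_and] at h ⊢
      obtain ⟨⟨h1, h2⟩, h3, h4⟩ := h
      exact ⟨⟨by rw [card_insert_of_notMem h3, h1], h4⟩, mem_insert_self _ _,
        by rw [erase_insert h3, h2]⟩
    · rintro ⟨σ, x⟩ h
      simp only [doors, up, rooms, down, coe_sigma, Set.mem_sigma_iff, mem_coe, mem_filter,
        mem_univ, true_and] at h ⊢
      obtain ⟨⟨h1, h2⟩, h3, h4⟩ := h
      exact ⟨⟨by rw [card_erase_add_one h3, h1], h4⟩, by simp, by rwa [insert_erase h3]⟩
    · rintro ⟨τ, x⟩ h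
      simp only [up, coe_sigma, Set.mem_sigma_iff, mem_coe, mem_filter] at h
      simp [erase_insert h.2.2.1]
    · rintro ⟨σ, x⟩ h
      simp only [down, coe_sigma, Set.mem_sigma_iff, mem_coe, mem_filter] at h
      simp [insert_erase h.2.1]
  have heven : Even (∑ σ ∈ rooms, #(down σ)) := by
    refine Finset.even_sum _ fun σ hσ => ?_
    simp only [rooms, mem_filter, mem_univ, true_and] at hσ
    exact even_card_colored_facets hσ.1 i₀ (hno σ hσ.2)
  have hmem : (univ.erase i₀).image s ∈ doors := by
    simp only [doors, mem_filter, mem_univ, true_and]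
    refine ⟨?_, ?_⟩
    · rw [card_image_of_injective _ hs, card_erase_add_one (mem_univ _), card_univ]
    · rw [image_image, show c ∘ s = id from funext hcs, image_id]
  rw [← hcount, ← add_sum_erase _ _ hmem] at heven
  have h1 : #(up ((univ.erase i₀).image s)) = 1 :=
    card_dominant_insert_slack hr hlow hhigh hs i₀
  have h2 : Even (∑ τ ∈ doors.erase ((univ.erase i₀).image s), #(up τ)) := by
    refine Finset.even_sum _ fun τ hτ => ?_
    simp only [doors, mem_erase, mem_filter, mem_univ, true_and] at hτ
    obtain ⟨hne, hcard, himg⟩ := hτ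
    obtain ⟨t, ht, hts⟩ : ∃ t ∈ τ, t ∉ Set.range s := by
      by_contra! h
      refine hne ?_
      have hsc : ∀ x ∈ τ, s (c x) = x := fun x hx => by
        obtain ⟨i, rfl⟩ := h x hx
        rw [hcs]
      rw [← himg, image_image]
      ext x
      simp only [mem_image, Function.comp_apply]
      exact ⟨fun hx => ⟨x, hx, hsc x hx⟩, fun ⟨y, hy, hyx⟩ => by rwa [← hyx, hsc y hy]⟩
    exact even_card_dominant_insert hr hcard ht fun i j hij => hhigh i j t hij hts
  rw [h1, Nat.even_add] at heven
  exact absurd (heven.mpr h2) (by decide)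

end Scarf

/-- Scarf's theorem with the slack points eliminated. -/
theorem exists_dominant_labels {I T : Type*} [Fintype I] [DecidableEq I] [Fintype T] [Nonempty T]
    {g : I → T → ℕ} (hg : ∀ i, Function.Injective (g i)) (c : T → I) :
    ∃ σ : Finset T, σ.Nonempty ∧ ∀ y, ∃ i ∈ σ.image c, ∀ x ∈ σ, g i y ≤ g i x := by
  classical
  have : Nonempty I := ‹Nonempty T›.map c
  obtain ⟨K, hK⟩ : ∃ K, ∀ i t, g i t < K := by
    refine ⟨∑ i, ∑ t, g i t + 1, fun i t => Nat.lt_succ_of_le ?_⟩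
    exact (single_le_sum (f := g i) (fun _ _ => Nat.zero_le _) (mem_univ t)).trans
      (single_le_sum (f := fun i => ∑ t, g i t) (fun _ _ => Nat.zero_le _) (mem_univ i))
  let e := Fintype.equivFin I
  let r : I → T ⊕ I → ℕ := fun i =>
    Sum.elim (fun t => g i t + 1) (fun j => if j = i then 0 else K + 1 + e j)
  have hr : ∀ i, Function.Injective (r i) := by
    rintro i (x | x) (y | y) h
    · exact congrArg _ (hg i (by simpa [r] using h))
    · have := hK i x
      simp only [r, Sum.elim_inl, Sum.elim_inr] at h
      split_ifs at h
      omega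
    · have := hK i y
      simp only [r, Sum.elim_inl, Sum.elim_inr] at h
      split_ifs at h
      omega
    · simp only [r, Sum.elim_inr] at h
      split_ifs at h with h1 h2 h2
      · rw [h1, h2]
      · omega
      · omega
      · exact congrArg _ (e.injective (Fin.ext (by omega)))
  obtain ⟨σ, hσ, hc⟩ := exists_dominant_colorful hr (s := Sum.inr) (c := Sum.elim c id)
    (fun i y => by simp [r])
    (fun i j y hij hy => by
      rcases y with y | y
      · have := hK i y
        simp only [r, Sum.elim_inl, Sum.elim_inr, if_neg hij]
        omega
      · exact absurd ⟨y, rfl⟩ hy)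
    (fun i => rfl)
  let τ : Finset T := {t | Sum.inl t ∈ σ}
  have hτ : ∀ y, ∃ i ∈ τ.image c, ∀ x ∈ τ, g i y ≤ g i x := by
    intro y
    obtain ⟨i, hi⟩ := hσ (Sum.inl y)
    refine ⟨i, ?_, fun x hx => ?_⟩
    · obtain ⟨u, hu, hui⟩ := mem_image.mp (hc ▸ mem_univ i : i ∈ σ.image (Sum.elim c id))
      rcases u with t | j
      · exact mem_image.mpr ⟨t, by simpa [τ] using hu, hui⟩
      · obtain rfl : j = i := hui
        simpa [r] using hi _ hu
    · simpa [r] using hi (Sum.inl x) (by simpa [τ] using hx)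
  refine ⟨τ, ?_, hτ⟩
  obtain ⟨y⟩ := ‹Nonempty T›
  obtain ⟨i, hi, -⟩ := hτ y
  exact Finset.image_nonempty.mp ⟨i, hi⟩

/-- For any labelling of the grid points of the `k`-fold simplex there is a small cluster of grid
points such that each coordinate is either small on the cluster or occurs as a label in it. -/
theorem exists_grid_cluster {n : ℕ} (k : ℕ) (hn : 0 < n) (c : (Fin n → ℕ) → Fin n) :
    ∃ x : Fin n → ℕ, ∑ i, x i = k ∧ ∀ i, x i ≤ n ∨
      ∃ y : Fin n → ℕ, ∑ i, y i = k ∧ c y = i ∧ ∀ j, x j ≤ y j + n ∧ y j ≤ x j + n := by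
  classical
  let T := {x // x ∈ piAntidiag (univ : Finset (Fin n)) k}
  have hTsum : ∀ x : T, ∑ i, x.1 i = k := fun x => (mem_piAntidiag.mp x.2).1
  have hT : ∀ x : Fin n → ℕ, ∑ i, x i = k → x ∈ piAntidiag (univ : Finset (Fin n)) k :=
    fun x hx => mem_piAntidiag.mpr ⟨hx, fun _ _ => mem_univ _⟩
  have : Nonempty T := ⟨⟨Pi.single ⟨0, hn⟩ k, hT _ (by simp)⟩⟩
  let e := Fintype.equivFin T
  let N := Fintype.card T
  let g : Fin n → T → ℕ := fun i x => e x + N * x.1 i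
  have hN : 0 < N := Fintype.card_pos
  have hdiv : ∀ i x, g i x / N = x.1 i := fun i x => by
    simp only [g]
    rw [Nat.add_mul_div_left _ _ hN, Nat.div_eq_of_lt (e x).2, zero_add]
  have hg : ∀ i, Function.Injective (g i) := fun i x y h => by
    have h1 : x.1 i = y.1 i := by rw [← hdiv i x, h, hdiv]
    simp only [g, h1] at h
    exact e.injective (Fin.ext (by omega))
  obtain ⟨σ, hσ, hdom⟩ := exists_dominant_labels hg (fun x : T => c x.1)
  set C := σ.image (fun x : T => c x.1) with hC
  choose q hqσ hq using fun i => Finset.exists_min_image σ (fun x : T => x.1 i) hσ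
  have hsum : k < ∑ i ∈ C, ((q i).1 i + 1) := by
    by_contra! h
    obtain ⟨x, hx⟩ := hσ
    have hxC : c x.1 ∈ C := mem_image_of_mem _ hx
    let y : Fin n → ℕ := (fun i => if i ∈ C then (q i).1 i + 1 else 0) +
      Pi.single (c x.1) (k - ∑ i ∈ C, ((q i).1 i + 1))
    have hy : ∑ i, y i = k := by
      simp only [y, Pi.add_apply, sum_add_distrib, sum_ite_mem, univ_inter, sum_pi_single',
        mem_univ, if_true] at h ⊢
      simp at h ⊢
      omega
    obtain ⟨i, hi, hle⟩ := hdom ⟨y, hT y hy⟩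
    have h1 := Nat.div_le_div_right (c := N) (hle (q i) (hqσ i))
    rw [hdiv, hdiv] at h1
    simp only [y, Pi.add_apply, if_pos hi] at h1
    omega
  have hsum' : k < ∑ i ∈ C, (q i).1 i + n := by
    rw [sum_add_distrib] at hsum
    have : ∑ i ∈ C, 1 ≤ n := by simpa using card_le_univ C
    omega
  have hbd : ∀ x ∈ σ, ∀ i, x.1 i ≤ (if i ∈ C then (q i).1 i else 0) + n := by
    intro x hx i
    have h1 := hTsum x
    rw [← add_sum_erase _ _ (mem_univ i)] at h1
    have h2 : ∑ j, (if j ∈ C then (q j).1 j else 0) = ∑ j ∈ C, (q j).1 j := by simp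
    rw [← add_sum_erase _ _ (mem_univ i)] at h2
    have h3 : ∑ j ∈ univ.erase i, (if j ∈ C then (q j).1 j else 0) ≤ ∑ j ∈ univ.erase i, x.1 j :=
      sum_le_sum fun j _ => by
        split_ifs
        · exact hq j x hx
        · exact Nat.zero_le _
    omega
  have hlow : ∀ x ∈ σ, ∀ i, (if i ∈ C then (q i).1 i else 0) ≤ x.1 i := fun x hx i => by
    split_ifs
    · exact hq i x hx
    · exact Nat.zero_le _
  obtain ⟨x, hx⟩ := hσ
  refine ⟨x.1, hTsum x, fun i => ?_⟩
  by_cases hi : i ∈ C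
  · obtain ⟨y, hy, hyi⟩ := mem_image.mp hi
    exact Or.inr ⟨y.1, hTsum y, hyi, fun j =>
      ⟨(hbd x hx j).trans (Nat.add_le_add_right (hlow y hy j) _),
        (hbd y hy j).trans (Nat.add_le_add_right (hlow x hx j) _)⟩⟩
  · exact Or.inl (by simpa [hi] using hbd x hx i)

/-- A covering theorem of Knaster–Kuratowski–Mazurkiewicz type: if closed sets `P i` cover the
simplex, then some point of the simplex lies in every `P i` whose coordinate is nonzero. -/
theorem exists_mem_of_closed_cover {n : ℕ} (hn : 0 < n) {P : Fin n → Set (Fin n → ℝ)}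
    (hP : ∀ i, IsClosed (P i)) (hcov : ∀ x ∈ stdSimplex ℝ (Fin n), ∃ i, x ∈ P i) :
    ∃ x ∈ stdSimplex ℝ (Fin n), ∀ i, x i ≠ 0 → x ∈ P i := by
  classical
  let sc : ℕ → (Fin n → ℕ) → Fin n → ℝ := fun k x i => x i / (k + 1)
  have hsc : ∀ k x, ∑ i, x i = k + 1 → sc k x ∈ stdSimplex ℝ (Fin n) := fun k x hx => by
    refine ⟨fun i => by positivity, ?_⟩
    simp only [sc]
    rw [← sum_div, div_eq_one_iff_eq (by positivity)]
    exact_mod_cast hx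
  let c : ℕ → (Fin n → ℕ) → Fin n := fun k x =>
    if h : ∃ i, sc k x ∈ P i then h.choose else ⟨0, hn⟩
  have hc : ∀ k x, ∑ i, x i = k + 1 → sc k x ∈ P (c k x) := fun k x hx => by
    have h := hcov _ (hsc k x hx)
    simp only [c, dif_pos h]
    exact h.choose_spec
  choose u hu hu' using fun k => exists_grid_cluster (k + 1) hn (c k)
  obtain ⟨a, ha, φ, hφ, hlim⟩ := (isCompact_stdSimplex ℝ (Fin n)).tendsto_subseq
    (fun k => hsc k (u k) (hu k))
  have hsmall : Filter.Tendsto (fun k : ℕ => (n : ℝ) / (φ k + 1)) Filter.atTop (nhds 0) := by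
    have h : Filter.Tendsto (fun k : ℕ => (n : ℝ) / (k + 1)) Filter.atTop (nhds 0) := by
      simpa [div_eq_mul_inv] using
        (tendsto_one_div_add_atTop_nhds_zero_nat (𝕜 := ℝ)).const_mul (n : ℝ)
    exact h.comp hφ.tendsto_atTop
  refine ⟨a, ha, fun i hi => ?_⟩
  have hai : 0 < a i := lt_of_le_of_ne (ha.1 i) hi.symm
  rw [← (hP i).closure_eq, Metric.mem_closure_iff]
  intro ε hε
  have e1 := (tendsto_pi_nhds.mp hlim i).eventually (lt_mem_nhds (half_lt_self hai))
  have e2 := hsmall.eventually (gt_mem_nhds (half_pos hai))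
  have e3 := hsmall.eventually (gt_mem_nhds (half_pos hε))
  have e4 := (Metric.tendsto_nhds.mp hlim) (ε / 2) (half_pos hε)
  obtain ⟨k, h1, h2, h3, h4⟩ := (e1.and (e2.and (e3.and e4))).exists
  have hpos : (0 : ℝ) < φ k + 1 := by positivity
  rcases hu' (φ k) i with h | ⟨y, hy, hyi, hclose⟩
  · have : ((u (φ k) i : ℕ) : ℝ) / (φ k + 1) ≤ n / (φ k + 1) := by
      gcongr
    simp only [Function.comp_apply, sc] at h1
    linarith
  · refine ⟨sc (φ k) y, hyi ▸ hc _ _ hy, ?_⟩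
    have h5 : dist (sc (φ k) (u (φ k))) (sc (φ k) y) ≤ n / (φ k + 1) := by
      rw [dist_pi_le_iff (by positivity)]
      intro j
      have hj1 : ((u (φ k) j : ℕ) : ℝ) ≤ y j + n := by exact_mod_cast (hclose j).1
      have hj2 : (y j : ℝ) ≤ u (φ k) j + n := by exact_mod_cast (hclose j).2
      rw [Real.dist_eq, ← sub_div, abs_div, abs_of_pos hpos]
      gcongr
      rw [abs_le]
      constructor <;> linarith
    rw [dist_comm] at h4
    calc dist a (sc (φ k) y)
        ≤ dist a (sc (φ k) (u (φ k))) + dist (sc (φ k) (u (φ k))) (sc (φ k) y) :=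
          dist_triangle _ _ _
      _ < ε / 2 + ε / 2 := add_lt_add_of_lt_of_le h4 (h5.trans h3.le)
      _ = ε := add_halves ε

theorem continuous_tmap {m n : ℕ} [NeZero m] (A : (Fin m → Fin n) → ℝ) (i : Fin n) :
    Continuous fun x => tmap A x i := by
  unfold tmap
  refine continuous_finsetSum _ fun j _ => ?_
  split_ifs <;> fun_prop

theorem continuous_tpow {m n : ℕ} (A : (Fin m → Fin n) → ℝ) : Continuous (tpow A) := by
  unfold tpow
  fun_prop

/-- `⟨x, 𝒜x^{m-1}⟩ = 𝒜x^m`. -/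
theorem sum_mul_tmap {m n : ℕ} [NeZero m] (A : (Fin m → Fin n) → ℝ) (x : Fin n → ℝ) :
    ∑ i, x i * tmap A x i = tpow A x := by
  simp only [tmap, tpow, mul_sum]
  rw [sum_comm]
  refine sum_congr rfl fun j _ => ?_
  simp only [mul_ite, mul_zero, sum_ite_eq, mem_univ, if_true]
  rw [← mul_prod_erase univ (fun k => x (j k)) (mem_univ 0)]
  ring

/-- The complementarity problem on the simplex: a field that is orthogonal to the position vector
is nonnegative somewhere. -/
theorem exists_nonneg_of_sum_mul_eq_zero {n : ℕ} (hn : 0 < n) {F : (Fin n → ℝ) → Fin n → ℝ}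
    (hF : ∀ i, ContinuousOn (fun x => F x i) (stdSimplex ℝ (Fin n)))
    (horth : ∀ x ∈ stdSimplex ℝ (Fin n), ∑ i, x i * F x i = 0) :
    ∃ x ∈ stdSimplex ℝ (Fin n), ∀ i, 0 ≤ F x i := by
  have : Nonempty (Fin n) := ⟨⟨0, hn⟩⟩
  let G : (Fin n → ℝ) → Fin n → ℝ := fun x i => max (-F x i) 0 - x i * ∑ j, max (-F x j) 0
  have hG : ∀ i, ContinuousOn (fun x => G x i) (stdSimplex ℝ (Fin n)) := fun i => by
    fun_prop
  have hsum : ∀ x ∈ stdSimplex ℝ (Fin n), ∑ i, G x i = 0 := fun x hx => by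
    simp only [G, sum_sub_distrib, ← sum_mul, hx.2, one_mul, sub_self]
  obtain ⟨x, hx, hxG⟩ := exists_mem_of_closed_cover hn
    (P := fun i => stdSimplex ℝ (Fin n) ∩ (fun x => G x i) ⁻¹' Set.Ici 0)
    (fun i => (hG i).preimage_isClosed_of_isClosed (isClosed_stdSimplex ℝ (Fin n)) isClosed_Ici)
    (fun x hx => by
      by_contra! h
      refine absurd (hsum x hx) (ne_of_lt (sum_neg (fun i _ => ?_) univ_nonempty))
      simpa [hx] using h i)
  refine ⟨x, hx, ?_⟩
  have hGnonneg : ∀ i, 0 ≤ G x i := fun i => by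
    by_cases hi : x i = 0
    · simp [G, hi]
    · exact (hxG i hi).2
  have hGzero : ∀ i, G x i = 0 := fun i =>
    (sum_eq_zero_iff_of_nonneg fun i _ => hGnonneg i).mp (hsum x hx) i (mem_univ i)
  set s := ∑ j, max (-F x j) 0 with hs
  have hs0 : 0 ≤ s := sum_nonneg fun _ _ => le_max_right _ _
  have hfix : ∀ i, max (-F x i) 0 = x i * s := fun i => sub_eq_zero.mp (hGzero i)
  have hs' : s = 0 := by
    by_contra hne
    have hpos : 0 < s := lt_of_le_of_ne hs0 (Ne.symm hne)
    have hterm : ∀ i, x i * F x i = -(x i * x i * s) := fun i => by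
      rcases (hx.1 i).eq_or_lt with h | h
      · simp [← h]
      · have h1 := hfix i
        have h2 : 0 < x i * s := mul_pos h hpos
        rw [max_def] at h1
        split_ifs at h1
        · linarith
        · rw [mul_assoc, ← h1]
          ring
    have h0 := horth x hx
    simp only [hterm, sum_neg_distrib, neg_eq_zero] at h0
    rw [sum_eq_zero_iff_of_nonneg fun i _ => mul_nonneg (mul_self_nonneg (x i)) hs0] at h0
    have hx0 : ∀ i, x i = 0 := fun i => by simpa [hne] using h0 i (mem_univ i)
    simpa [hx0] using hx.2
  intro i
  have := hfix i
  rw [hs', mul_zero] at this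
  linarith [le_max_left (-F x i) 0]

/-- existence of a solution of TGEiCP with K = ℝ₊ⁿ for strictly copositive ℬ. -/
theorem tgeicp_pareto_exists {m n : ℕ} [NeZero m] (hn : 0 < n)
    (A B : (Fin m → Fin n) → ℝ)
    (hB : ∀ x : Fin n → ℝ, (∀ i, 0 ≤ x i) → x ≠ 0 → 0 < tpow B x) :
    ∃ (lam : ℝ) (x : Fin n → ℝ), (∀ i, 0 ≤ x i) ∧ x ≠ 0 ∧
      (∀ i, 0 ≤ lam * tmap B x i - tmap A x i) ∧
      ∑ i, x i * (lam * tmap B x i - tmap A x i) = 0 := by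
  have hne : ∀ x ∈ stdSimplex ℝ (Fin n), x ≠ 0 := by
    rintro x hx rfl
    simpa using hx.2
  have hpos : ∀ x ∈ stdSimplex ℝ (Fin n), tpow B x ≠ 0 := fun x hx =>
    (hB x hx.1 (hne x hx)).ne'
  have horth : ∀ x ∈ stdSimplex ℝ (Fin n),
      ∑ i, x i * (tpow A x / tpow B x * tmap B x i - tmap A x i) = 0 := fun x hx => by
    simp only [mul_sub, sum_sub_distrib, mul_left_comm (x _), ← mul_sum, sum_mul_tmap]
    rw [div_mul_cancel₀ _ (hpos x hx), sub_self]
  obtain ⟨x, hx, hxF⟩ := exists_nonneg_of_sum_mul_eq_zero hn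
    (F := fun x i => tpow A x / tpow B x * tmap B x i - tmap A x i)
    (fun i => (((continuous_tpow A).continuousOn.div (continuous_tpow B).continuousOn hpos).mul
      (continuous_tmap B i).continuousOn).sub (continuous_tmap A i).continuousOn) horth
  exact ⟨tpow A x / tpow B x, x, hx.1, hne x hx, hxF, horth x hx⟩
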